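/- arXiv:2511.07160 — 6 statements merged into one kernel-verified Lean document; each statement's English description precedes it below -/
import Mathlib

section
/- Let T be a finite tree (connected acyclic simple graph) with at least two vertices, and let ℓ be the number of leaves of T (vertices of degree 1). Then the minimum size of a path cover of T equals ⌈ℓ/2⌉; that is, there exists a path cover of T of size ⌈ℓ/2⌉, and every path cover of T has size at least ⌈ℓ/2⌉. -/
/-- `l` is (the vertex list of) a path in `G`: it is nonempty, has no repeated
vertices, and consecutive vertices are adjacent in `G`. -/
def IsPathList {V : Type*} (G : SimpleGraph V) (l : List V) : Prop :=
  l ≠ [] ∧ l.Nodup ∧ l.Chain' G.Adj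

/-- `C` is a path cover of `G`: a finite set of paths of `G` such that every
vertex of `G` belongs to at least one of the paths. -/
def IsPathCover {V : Type*} (G : SimpleGraph V) (C : Finset (List V)) : Prop :=
  (∀ l ∈ C, IsPathList G l) ∧ ∀ v : V, ∃ l ∈ C, v ∈ l

namespace PCTree
open SimpleGraph

variable {V : Type*} {T : SimpleGraph V}

/-- `v` separates `a` from `b`. -/
def Btw (T : SimpleGraph V) (a v b : V) : Prop := ∀ p : T.Walk a b, v ∈ p.support

lemma Btw.trans_or {a v c : V} (h : Btw T a v c) (b : V) : Btw T a v b ∨ Btw T b v c := by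
  by_contra! hcon
  obtain ⟨h1, h2⟩ := hcon
  simp only [Btw, not_forall] at h1 h2
  obtain ⟨p, hp⟩ := h1
  obtain ⟨q, hq⟩ := h2
  have := h (p.append q)
  rw [Walk.mem_support_append_iff] at this
  tauto

lemma Btw.symm {a v c : V} (h : Btw T a v c) : Btw T c v a := by
  intro p
  have := h p.reverse
  simpa using this

lemma btw_of_path [DecidableEq V] (hT : T.IsAcyclic) {a v c : V} (p : T.Walk a c) (hp : p.IsPath)
    (hv : v ∈ p.support) : Btw T a v c := by
  intro q
  have h := hT.path_unique ⟨p, hp⟩ ⟨q.bypass, q.bypass_isPath⟩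
  have h2 : p = q.bypass := congrArg Subtype.val h
  rw [h2] at hv
  exact q.support_bypass_subset hv

lemma length_path (hT : T.IsAcyclic) (hc : T.Connected) {a c : V} (p : T.Walk a c)
    (hp : p.IsPath) : p.length = T.dist a c := by
  obtain ⟨q, hq, hl⟩ := hc.exists_path_of_dist a c
  have h := hT.path_unique ⟨p, hp⟩ ⟨q, hq⟩
  have h2 : p = q := congrArg Subtype.val h
  rw [h2, hl]

lemma Btw.dist_eq [DecidableEq V] (hc : T.Connected) {a v c : V} (h : Btw T a v c) :
    T.dist a v + T.dist v c = T.dist a c := by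
  apply le_antisymm _ hc.dist_triangle
  obtain ⟨q, hl⟩ := hc.exists_walk_length_eq_dist a c
  have hv := h q
  have h1 := dist_le (q.takeUntil v hv)
  have h2 := dist_le (q.dropUntil v hv)
  have h3 := congrArg Walk.length (q.take_spec hv)
  rw [Walk.length_append] at h3
  omega

lemma dist_lt_of_not_btw [DecidableEq V] (hT : T.IsAcyclic) (hc : T.Connected) {a v c : V}
    (h : ¬ Btw T a v c) : T.dist a c < T.dist a v + T.dist v c := by
  by_contra! hle
  apply h
  obtain ⟨p, hp⟩ := hc.exists_walk_length_eq_dist a v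
  obtain ⟨q, hq⟩ := hc.exists_walk_length_eq_dist v c
  have h3 : T.dist a c ≤ T.dist a v + T.dist v c := hc.dist_triangle
  apply btw_of_path hT (p.append q)
  · apply Walk.isPath_of_length_eq_dist
    rw [Walk.length_append]
    omega
  · rw [Walk.mem_support_append_iff]
    left
    simp

lemma exists_leaves [Fintype V] [DecidableEq V] [DecidableRel T.Adj] (hT : T.IsAcyclic)
    (hc : T.Connected) (hcard : 2 ≤ Fintype.card V) (v : V) :
    ∃ a c, T.degree a = 1 ∧ T.degree c = 1 ∧ Btw T a v c := by
  classical
  haveI : Nontrivial V := Fintype.one_lt_card_iff_nontrivial.1 hcard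
  obtain ⟨⟨a, c⟩, hm, hmax⟩ := Finset.exists_max_image
    (Finset.univ.filter fun x : V × V => Btw T x.1 v x.2) (fun x => T.dist x.1 x.2)
    ⟨(v, v), Finset.mem_filter.2 ⟨Finset.mem_univ _, fun p => p.start_mem_support⟩⟩
  simp only [Finset.mem_filter, Finset.mem_univ, true_and, Prod.forall] at hm hmax
  have key : ∀ a c : V, Btw T a v c → (∀ a' c', Btw T a' v c' → T.dist a' c' ≤ T.dist a c) →
      T.degree a = 1 := by
    intro a c hm hmax
    obtain ⟨p, hp, hl⟩ := hc.exists_path_of_dist a c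
    have hall : ∀ a', T.Adj a a' → a' = p.snd := by
      intro a' ha
      apply hT.eq_snd_of_adj_start hp ha
      by_contra hns
      have hq : (Walk.cons ha.symm p).IsPath := hp.cons hns
      have hb : Btw T a' v c := btw_of_path hT _ hq (by
        rw [Walk.support_cons]; exact List.mem_cons_of_mem _ (hm p))
      have := hmax _ _ hb
      rw [← length_path hT hc _ hq, Walk.length_cons] at this
      omega
    have hpos : 0 < T.degree a := hc.preconnected.degree_pos_of_nontrivial a
    have hle : T.degree a ≤ 1 := by
      rw [← card_neighborFinset_eq_degree, Finset.card_le_one]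
      intro x hx y hy
      rw [mem_neighborFinset] at hx hy
      rw [hall x hx, hall y hy]
    omega
  refine ⟨a, c, key a c hm hmax, key c a hm.symm ?_, hm⟩
  intro a' c' h
  rw [T.dist_comm (u := c)]
  exact hmax _ _ h

lemma leaf_end [Fintype V] [DecidableEq V] [DecidableRel T.Adj] {l : List V}
    (hl : IsPathList T l) {u : V} (hu : u ∈ l) (hd : T.degree u = 1) (d : V) :
    u = l.headD d ∨ u = l.getLastD d := by
  obtain ⟨-, hn, hch⟩ := hl
  obtain ⟨s, t, rfl⟩ := List.append_of_mem hu
  rcases List.eq_nil_or_concat s with rfl | ⟨s, x, rfl⟩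
  · left; simp
  rcases t with _ | ⟨y, t⟩
  · right; simp
  exfalso
  have hch' : List.IsChain T.Adj (s.concat x ++ u :: y :: t) := hch
  rw [List.concat_eq_append] at hch'
  have hx : T.Adj x u := by
    simp [List.isChain_append, List.isChain_cons_cons] at hch'
    grind
  have hy : T.Adj u y := by
    simp [List.isChain_append, List.isChain_cons_cons] at hch'
    grind
  have hne : x ≠ y := by
    rintro rfl
    simp [List.nodup_append] at hn
  have : T.degree u ≤ 1 := hd.le
  rw [← card_neighborFinset_eq_degree, Finset.card_le_one] at this
  exact hne (this x (by simpa using hx.symm) y (by simpa using hy))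

lemma lower [Fintype V] [DecidableEq V] [DecidableRel T.Adj] [Nonempty V] {C : Finset (List V)}
    (hC : IsPathCover T C) :
    (Finset.univ.filter fun v => T.degree v = 1).card ≤ 2 * C.card := by
  obtain ⟨d⟩ := ‹Nonempty V›
  have hsub : (Finset.univ.filter fun v => T.degree v = 1) ⊆
      C.image (fun l => l.headD d) ∪ C.image (fun l => l.getLastD d) := by
    intro u hu
    simp only [Finset.mem_filter, Finset.mem_univ, true_and] at hu
    obtain ⟨l, hlC, hul⟩ := hC.2 u
    rw [Finset.mem_union, Finset.mem_image, Finset.mem_image]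
    rcases leaf_end (hC.1 l hlC) hul hu d with h | h
    · exact Or.inl ⟨l, hlC, h.symm⟩
    · exact Or.inr ⟨l, hlC, h.symm⟩
  have h1 := Finset.card_le_card hsub
  have h2 := Finset.card_union_le (C.image (fun l => l.headD d)) (C.image (fun l => l.getLastD d))
  have h3 : (C.image (fun l => l.headD d)).card ≤ C.card := Finset.card_image_le
  have h4 : (C.image (fun l => l.getLastD d)).card ≤ C.card := Finset.card_image_le
  omega

lemma exists_pairs [Nonempty V] [DecidableEq V] (L : Finset V) (k : ℕ) (h : L.card ≤ 2 * k) :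
    ∃ f : Fin k → V × V, ∀ u ∈ L, ∃ i, u = (f i).1 ∨ u = (f i).2 := by
  obtain ⟨d⟩ := ‹Nonempty V›
  let g : ℕ → V := fun n => if h : n < L.card then (L.equivFin.symm ⟨n, h⟩ : V) else d
  refine ⟨fun i => (g (2 * i), g (2 * i + 1)), fun u hu => ?_⟩
  have hg : g (L.equivFin ⟨u, hu⟩) = u := by simp [g]
  have hlt := (L.equivFin ⟨u, hu⟩).2
  generalize (L.equivFin ⟨u, hu⟩ : ℕ) = n at hg hlt
  refine ⟨⟨n / 2, by omega⟩, ?_⟩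
  rcases Nat.mod_two_eq_zero_or_one n with h0 | h0
  · left
    have : 2 * (n / 2) = n := by omega
    simp [this, hg]
  · right
    have : 2 * (n / 2) + 1 = n := by omega
    simp [this, hg]

lemma sum_swap {k : ℕ} {α : Type*} (F : α → ℕ) (f : Fin k → α) {i j : Fin k} (hij : i ≠ j)
    (x y : α) (h : F (f i) + F (f j) < F x + F y) :
    ∑ m, F (f m) < ∑ m, F (Function.update (Function.update f i x) j y m) := by
  have hj : j ∈ Finset.univ.erase i := by simp [hij.symm]
  rw [← Finset.add_sum_erase _ _ (Finset.mem_univ i), ← Finset.add_sum_erase _ _ hj,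
    ← Finset.add_sum_erase (Finset.univ) (fun m => F (Function.update (Function.update f i x) j y m))
      (Finset.mem_univ i), ← Finset.add_sum_erase (Finset.univ.erase i)
      (fun m => F (Function.update (Function.update f i x) j y m)) hj]
  have : ∑ m ∈ (Finset.univ.erase i).erase j, F (Function.update (Function.update f i x) j y m)
      = ∑ m ∈ (Finset.univ.erase i).erase j, F (f m) := by
    apply Finset.sum_congr rfl
    intro m hm
    simp only [Finset.mem_erase] at hm
    rw [Function.update_of_ne hm.1, Function.update_of_ne hm.2.1]
  rw [this]
  simp only [Function.update_self, Function.update_of_ne hij]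
  omega

lemma exists_cover_pairs [Fintype V] [DecidableEq V] [DecidableRel T.Adj] (hT : T.IsAcyclic)
    (hc : T.Connected) (hcard : 2 ≤ Fintype.card V) (k : ℕ)
    (hk : (Finset.univ.filter fun v => T.degree v = 1).card ≤ 2 * k) :
    ∃ f : Fin k → V × V, ∀ v, ∃ i, Btw T (f i).1 v (f i).2 := by
  classical
  haveI := hc.nonempty
  obtain ⟨f0, hf0⟩ := exists_pairs _ k hk
  obtain ⟨f, hf, hmax⟩ := Finset.exists_max_image
    (Finset.univ.filter fun f : Fin k → V × V =>
      ∀ u, T.degree u = 1 → ∃ i, u = (f i).1 ∨ u = (f i).2)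
    (fun f => ∑ m, T.dist (f m).1 (f m).2) ⟨f0, by simpa using hf0⟩
  simp only [Finset.mem_filter, Finset.mem_univ, true_and] at hf hmax
  refine ⟨f, fun v => ?_⟩
  by_contra! hv
  obtain ⟨a, c, ha, hcd, hb⟩ := exists_leaves hT hc hcard v
  obtain ⟨i, hi⟩ := hf a ha
  obtain ⟨j, hj⟩ := hf c hcd
  have hvi := hv i
  have hvj := hv j
  have hvi' : ¬ Btw T (f i).2 v (f i).1 := fun h => hvi h.symm
  have hvj' : ¬ Btw T (f j).2 v (f j).1 := fun h => hvj h.symm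
  -- from any end of `i` to any end of `j`
  have step1 : Btw T (f i).1 v c ∧ Btw T (f i).2 v c := by
    rcases hi with rfl | rfl
    · exact ⟨hb, (hb.trans_or _).resolve_left hvi⟩
    · exact ⟨(hb.trans_or _).resolve_left hvi', hb⟩
  have step2 : Btw T (f i).1 v (f j).1 ∧ Btw T (f i).2 v (f j).2 := by
    rcases hj with rfl | rfl
    · exact ⟨step1.1, (step1.2.trans_or _).resolve_right hvj'⟩
    · exact ⟨(step1.1.trans_or _).resolve_right hvj, step1.2⟩
  have hij : i ≠ j := by
    rintro rfl
    rcases hj with rfl | rfl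
    · exact hvi' step1.2
    · exact hvi step1.1
  have hlt := sum_swap (fun x : V × V => T.dist x.1 x.2) f hij ((f i).1, (f j).1)
    ((f i).2, (f j).2) (by
      have h1 := dist_lt_of_not_btw hT hc hvi
      have h2 := dist_lt_of_not_btw hT hc hvj
      have h3 := step2.1.dist_eq hc
      have h4 := step2.2.dist_eq hc
      rw [T.dist_comm (u := v) (v := (f i).2)] at h1
      rw [T.dist_comm (u := (f j).1) (v := v)] at h2
      simp only
      omega)
  refine absurd (hmax _ ?_) (not_le.2 hlt)
  intro u hu
  obtain ⟨m, hm⟩ := hf u hu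
  by_cases hmi : m = i
  · subst hmi
    rcases hm with h | h
    · exact ⟨m, by simp [Function.update_of_ne hij, h]⟩
    · exact ⟨j, by simp [h]⟩
  by_cases hmj : m = j
  · subst hmj
    rcases hm with h | h
    · exact ⟨i, by simp [Function.update_of_ne hij, h]⟩
    · exact ⟨m, by simp [h]⟩
  exact ⟨m, by simpa [Function.update_of_ne hmj, Function.update_of_ne hmi] using hm⟩

end PCTree

/-- For a finite tree `T` with at least two vertices and `ℓ` leaves, the minimum
size of a path cover of `T` equals `⌈ℓ/2⌉`. -/
theorem pathCover_tree_min {V : Type*} [Fintype V] [DecidableEq V]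
    (T : SimpleGraph V) [DecidableRel T.Adj]
    (hconn : T.Connected) (hacyclic : T.IsAcyclic)
    (hcard : 2 ≤ Fintype.card V)
    (ℓ : ℕ) (hℓ : ℓ = Nat.card {v : V // T.degree v = 1}) :
    IsLeast {n : ℕ | ∃ C : Finset (List V), IsPathCover T C ∧ C.card = n}
      ((ℓ + 1) / 2) := by
  haveI := hconn.nonempty
  have hL : (Finset.univ.filter fun v => T.degree v = 1).card = ℓ := by
    rw [hℓ, Nat.card_eq_fintype_card, Fintype.card_subtype]
  constructor
  · obtain ⟨f, hf⟩ := PCTree.exists_cover_pairs hacyclic hconn hcard ((ℓ + 1) / 2)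
      (by rw [hL]; omega)
    choose P hP _ using fun x : V × V => hconn.exists_path_of_dist x.1 x.2
    have hcov : IsPathCover T (Finset.univ.image fun i => (P (f i)).support) := by
      constructor
      · intro l hl
        rw [Finset.mem_image] at hl
        obtain ⟨i, -, rfl⟩ := hl
        exact ⟨(P (f i)).support_ne_nil, (hP (f i)).support_nodup,
          (P (f i)).isChain_adj_support⟩
      · intro v
        obtain ⟨i, hi⟩ := hf v
        exact ⟨_, Finset.mem_image_of_mem _ (Finset.mem_univ i), hi _⟩
    refine ⟨_, hcov, le_antisymm ?_ ?_⟩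
    · exact Finset.card_image_le.trans (by simp)
    · have := PCTree.lower hcov
      rw [hL] at this
      omega
  · rintro n ⟨C, hC, rfl⟩
    have := PCTree.lower hC
    rw [hL] at this
    omega
end

section
/- Let T be a finite tree (connected acyclic simple graph) with at least two vertices, and let ℓ be the number of leaves of T (vertices of degree 1). Then there exists a path cover of T of size exactly ⌈ℓ/2⌉. -/
open SimpleGraph in
def SAvoid {V : Type*} (T : SimpleGraph V) (v x y : V) : Prop :=
  ∃ p : T.Walk x y, v ∉ p.support

lemma SAvoid.symm {V : Type*} {T : SimpleGraph V} {v x y : V} (h : SAvoid T v x y) :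
    SAvoid T v y x := by
  obtain ⟨p, hp⟩ := h
  exact ⟨p.reverse, by simpa using hp⟩

lemma SAvoid.trans {V : Type*} {T : SimpleGraph V} {v x y z : V} (h : SAvoid T v x y)
    (h2 : SAvoid T v y z) : SAvoid T v x z := by
  obtain ⟨p, hp⟩ := h
  obtain ⟨q, hq⟩ := h2
  exact ⟨p.append q, by simp [SimpleGraph.Walk.mem_support_append_iff, hp, hq]⟩

lemma dist_ge_of_not_SAvoid {V : Type*} [DecidableEq V] {T : SimpleGraph V}
    (hconn : T.Connected) {v x y : V} (h : ¬ SAvoid T v x y) :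
    T.dist x v + T.dist v y ≤ T.dist x y := by
  obtain ⟨p, hp⟩ := hconn.exists_walk_length_eq_dist x y
  have hv : v ∈ p.support := by
    by_contra hv
    exact h ⟨p, hv⟩
  have h1 := T.dist_le (p.takeUntil v hv)
  have h2 := T.dist_le (p.dropUntil v hv)
  have h3 := congrArg SimpleGraph.Walk.length (p.take_spec hv)
  rw [SimpleGraph.Walk.length_append] at h3
  omega

lemma dist_lt_of_SAvoid {V : Type*} [DecidableEq V] {T : SimpleGraph V}
    (hconn : T.Connected) (hac : T.IsAcyclic) {v x y : V} (h : SAvoid T v x y) :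
    T.dist x y < T.dist x v + T.dist v y := by
  by_contra hcon
  obtain ⟨p, hp⟩ := h
  obtain ⟨q1, h1⟩ := hconn.exists_walk_length_eq_dist x v
  obtain ⟨q2, h2⟩ := hconn.exists_walk_length_eq_dist v y
  have h3 : (q1.append q2).length = T.dist x y := by
    have := T.dist_le (q1.append q2)
    rw [SimpleGraph.Walk.length_append] at *
    omega
  have h4 := SimpleGraph.Walk.isPath_of_length_eq_dist _ h3
  have h5 := hac.path_unique ⟨_, h4⟩ p.toPath
  have h6 : q1.append q2 = p.bypass := congrArg Subtype.val h5
  apply hp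
  apply p.support_bypass_subset
  rw [← h6]
  simp [SimpleGraph.Walk.mem_support_append_iff]

lemma not_SAvoid_nbrs {V : Type*} [DecidableEq V] {T : SimpleGraph V}
    (hac : T.IsAcyclic) {v a b : V} (ha : T.Adj v a) (hb : T.Adj v b)
    (hab : a ≠ b) : ¬ SAvoid T v a b := by
  rintro ⟨p, hp⟩
  let q : T.Walk a b := .cons ha.symm (.cons hb .nil)
  have hq : q.IsPath := by
    simp [q, SimpleGraph.Walk.cons_isPath_iff, hb.ne, ha.ne.symm, hab]
  have h5 := hac.path_unique ⟨_, hq⟩ p.toPath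
  have h6 : q = p.bypass := congrArg Subtype.val h5
  apply hp
  apply p.support_bypass_subset
  rw [← h6]
  simp [q]

lemma exists_leaf_SAvoid {V : Type*} [Fintype V] [DecidableEq V] {T : SimpleGraph V}
    [DecidableRel T.Adj]
    (hconn : T.Connected) (hac : T.IsAcyclic) {v a : V} (ha : T.Adj v a) :
    ∃ x, T.degree x = 1 ∧ SAvoid T v a x := by
  classical
  have haa : SAvoid T v a a := ⟨.nil, by simp [ha.ne]⟩
  obtain ⟨x, hx, hmax⟩ := Finset.exists_max_image
    (Finset.univ.filter fun x => SAvoid T v a x) (fun x => T.dist v x) ⟨a, by simpa using haa⟩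
  simp only [Finset.mem_filter, Finset.mem_univ, true_and] at hx hmax
  refine ⟨x, ?_, hx⟩
  have hxv : v ≠ x := by
    rintro rfl
    obtain ⟨p, hp⟩ := hx
    simp at hp
  have hnb : ∀ y, T.Adj x y → T.dist v x = T.dist v y + 1 := by
    intro y hy
    rcases (SimpleGraph.IsTree.mk hconn hac).dist_eq_dist_add_one_of_adj v hy with h | h
    · exact h
    · exfalso
      have hvy : v ≠ y := by
        rintro rfl
        simp at h
      have := hmax y (hx.trans ⟨.cons hy .nil, by simp [hxv, hvy]⟩)
      omega
  have huniq : ∀ y z, T.Adj x y → T.Adj x z → y = z := by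
    intro y z hy hz
    obtain ⟨p, hp⟩ := hconn.exists_walk_length_eq_dist v y
    obtain ⟨q, hq⟩ := hconn.exists_walk_length_eq_dist v z
    have h1 : (p.concat hy.symm).length = T.dist v x := by
      rw [SimpleGraph.Walk.length_concat, hp, hnb y hy]
    have h2 : (q.concat hz.symm).length = T.dist v x := by
      rw [SimpleGraph.Walk.length_concat, hq, hnb z hz]
    have h5 := hac.path_unique ⟨_, SimpleGraph.Walk.isPath_of_length_eq_dist _ h1⟩
      ⟨_, SimpleGraph.Walk.isPath_of_length_eq_dist _ h2⟩
    have h6 := congrArg (fun w : T.Path v x => w.1.penultimate) h5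
    simpa using h6
  rw [SimpleGraph.degree_eq_one_iff_existsUnique_adj]
  have : Nontrivial V := ⟨⟨v, x, hxv⟩⟩
  obtain ⟨y, hy⟩ := hconn.preconnected.exists_adj_of_nontrivial x
  exact ⟨y, hy, fun z hz => huniq z y hz hy⟩

theorem pathCover_tree_exists {V : Type*} [Fintype V] [DecidableEq V]
    (T : SimpleGraph V) [DecidableRel T.Adj]
    (hconn : T.Connected) (hacyclic : T.IsAcyclic)
    (hcard : 2 ≤ Fintype.card V)
    (ℓ : ℕ) (hℓ : ℓ = Nat.card {v : V // T.degree v = 1}) :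
    ∃ C : Finset (List V), IsPathCover T C ∧ C.card = (ℓ + 1) / 2 := by
  classical
  have hnt : Nontrivial V := Fintype.one_lt_card_iff_nontrivial.mp hcard
  obtain ⟨v0⟩ := hconn.nonempty
  set n := (ℓ + 1) / 2 with hn
  rw [Nat.card_eq_fintype_card] at hℓ
  have hℓV : ℓ ≤ Fintype.card V := hℓ ▸ Fintype.card_subtype_le _
  let P : Finset ((Fin n → V) × (Fin n → V)) :=
    Finset.univ.filter fun fg => ∀ x, T.degree x = 1 → ∃ i, fg.1 i = x ∨ fg.2 i = x
  have hP : P.Nonempty := by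
    obtain ⟨e⟩ : Nonempty ({v : V // T.degree v = 1} ↪ Fin n ⊕ Fin n) := by
      apply Function.Embedding.nonempty_of_card_le
      simp only [Fintype.card_sum, Fintype.card_fin]
      omega
    let h : Fin n ⊕ Fin n → V := Function.extend e Subtype.val (fun _ => v0)
    refine ⟨(fun i => h (.inl i), fun i => h (.inr i)), ?_⟩
    simp only [P, Finset.mem_filter, Finset.mem_univ, true_and]
    intro x hx
    have h1 : h (e ⟨x, hx⟩) = x := e.injective.extend_apply _ _ _
    rcases h2 : e ⟨x, hx⟩ with i | i
    · exact ⟨i, Or.inl (h2 ▸ h1)⟩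
    · exact ⟨i, Or.inr (h2 ▸ h1)⟩
  obtain ⟨⟨f, g⟩, hfg, hmax⟩ := Finset.exists_max_image P
    (fun fg => ∑ i, T.dist (fg.1 i) (fg.2 i)) hP
  simp only [P, Finset.mem_filter, Finset.mem_univ, true_and, Prod.forall] at hfg hmax
  choose p hp using fun i => hconn.exists_isPath (f i) (g i)
  let C : Finset (List V) := Finset.univ.image fun i => (p i).support
  have hC1 : ∀ l ∈ C, IsPathList T l := by
    intro l hl
    obtain ⟨i, -, rfl⟩ := Finset.mem_image.mp hl
    exact ⟨(p i).support_ne_nil, (hp i).support_nodup, (p i).isChain_adj_support⟩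
  have hC2 : ∀ v, ∃ l ∈ C, v ∈ l := by
    intro v
    by_contra hv
    have hv' : ∀ i, v ∉ (p i).support := fun i hi =>
      hv ⟨_, Finset.mem_image_of_mem _ (Finset.mem_univ i), hi⟩
    have hS : ∀ i, SAvoid T v (f i) (g i) := fun i => ⟨p i, hv' i⟩
    have hdeg : T.degree v ≠ 1 := by
      intro h
      obtain ⟨i, rfl | rfl⟩ := hfg v h
      · exact hv' i (p i).start_mem_support
      · exact hv' i (p i).end_mem_support
    obtain ⟨a, ha⟩ := hconn.preconnected.exists_adj_of_nontrivial v
    obtain ⟨b, hb, hab⟩ : ∃ b, T.Adj v b ∧ a ≠ b := by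
      by_contra hcon
      push Not at hcon
      exact hdeg (SimpleGraph.degree_eq_one_iff_existsUnique_adj.mpr
        ⟨a, ha, fun z hz => (hcon z hz).symm⟩)
    obtain ⟨x, hx, hax⟩ := exists_leaf_SAvoid hconn hacyclic ha
    obtain ⟨y, hy, hby⟩ := exists_leaf_SAvoid hconn hacyclic hb
    have key : ∀ z i, (f i = z ∨ g i = z) → ∀ c, SAvoid T v c z →
        SAvoid T v c (f i) ∧ SAvoid T v c (g i) := by
      rintro z i (rfl | rfl) c hc
      · exact ⟨hc, hc.trans (hS i)⟩
      · exact ⟨hc.trans (hS i).symm, hc⟩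
    obtain ⟨i, hi⟩ := hfg x hx
    obtain ⟨j, hj⟩ := hfg y hy
    obtain ⟨i1, i2⟩ := key x i hi a hax
    obtain ⟨j1, j2⟩ := key y j hj b hby
    have hno := not_SAvoid_nbrs hacyclic ha hb hab
    have n1 : ¬ SAvoid T v (f i) (g j) := fun h => hno (i1.trans (h.trans j2.symm))
    have n2 : ¬ SAvoid T v (f j) (g i) := fun h => hno (i2.trans (h.symm.trans j1.symm))
    have hij : j ≠ i := by
      rintro rfl
      exact n1 (hS _)
    have hm := hmax f (g ∘ Equiv.swap i j) (by
      intro z hz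
      obtain ⟨k, hk | hk⟩ := hfg z hz
      · exact ⟨k, Or.inl hk⟩
      · exact ⟨Equiv.swap i j k, Or.inr (by simpa using hk)⟩)
    have hji : j ∈ Finset.univ.erase i := by simp [hij]
    rw [← Finset.add_sum_erase _ _ (Finset.mem_univ i), ← Finset.add_sum_erase _ _ hji,
      ← Finset.add_sum_erase Finset.univ (fun i => T.dist (f i) (g i)) (Finset.mem_univ i),
      ← Finset.add_sum_erase _ (fun i => T.dist (f i) (g i)) hji] at hm
    have hs : ∑ k ∈ (Finset.univ.erase i).erase j, T.dist (f k) ((g ∘ Equiv.swap i j) k)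
        = ∑ k ∈ (Finset.univ.erase i).erase j, T.dist (f k) (g k) := by
      apply Finset.sum_congr rfl
      intro k hk
      simp only [Finset.mem_erase, Finset.mem_univ, and_true] at hk
      simp [Equiv.swap_apply_of_ne_of_ne hk.2 hk.1]
    rw [hs] at hm
    simp only [Function.comp, Equiv.swap_apply_left, Equiv.swap_apply_right] at hm
    have d1 := dist_ge_of_not_SAvoid hconn n1
    have d2 := dist_ge_of_not_SAvoid hconn n2
    have d3 := dist_lt_of_SAvoid hconn hacyclic (hS i)
    have d4 := dist_lt_of_SAvoid hconn hacyclic (hS j)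
    omega
  let S : Finset (List V) := Finset.univ.image fun v => [v]
  have hScard : S.card = Fintype.card V :=
    Finset.card_image_of_injective _ (fun a b h => by simpa using h)
  have hCcard : C.card ≤ n := Finset.card_image_le.trans (by simp)
  have hbig : n ≤ (C ∪ S).card := by
    have := Finset.card_le_card (Finset.subset_union_right : S ⊆ C ∪ S)
    omega
  obtain ⟨D, hCD, hDS, hD⟩ :=
    Finset.exists_subsuperset_card_eq (Finset.subset_union_left : C ⊆ C ∪ S) hCcard hbig
  refine ⟨D, ⟨fun l hl => ?_, fun v => ?_⟩, hD⟩
  · rcases Finset.mem_union.mp (hDS hl) with h | h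
    · exact hC1 l h
    · obtain ⟨w, -, rfl⟩ := Finset.mem_image.mp h
      exact ⟨by simp, by simp, List.isChain_singleton _⟩
  · obtain ⟨l, hl, h⟩ := hC2 v
    exact ⟨l, hCD hl, h⟩
end

section
/- Let T be a finite tree (connected acyclic simple graph) with at least two vertices, and let ℓ be the number of leaves of T (vertices of degree 1). Then the minimum number of paths of T needed so that every edge of T lies on at least one of the paths equals ⌈ℓ/2⌉. -/
/-- The set of paths `C` covers all edges of `G`: every edge of `G` lies on at
least one of the paths, i.e. its two endpoints appear consecutively on it. -/
def CoversEdges {V : Type*} (G : SimpleGraph V) (C : Finset (List V)) : Prop :=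
  ∀ e ∈ G.edgeSet, ∃ l ∈ C, ∃ a b : V, e = s(a, b) ∧ [a, b] <:+: l

namespace PathCover
open SimpleGraph

lemma infix_of_mem_edges {V : Type*} {G : SimpleGraph V} {x y : V} (p : G.Walk x y)
    (e : Sym2 V) (he : e ∈ p.edges) : ∃ a b : V, e = s(a, b) ∧ [a, b] <:+: p.support := by
  induction p with
  | nil => simp at he
  | @cons a b c h p ih =>
    rw [Walk.edges_cons, List.mem_cons] at he
    rcases he with rfl | he
    · refine ⟨a, b, rfl, ?_⟩
      cases p with
      | nil => simp
      | cons h' p' =>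
        rw [Walk.support_cons, Walk.support_cons]
        exact ⟨[], p'.support, rfl⟩
    · obtain ⟨a', b', h1, h2⟩ := ih he
      refine ⟨a', b', h1, ?_⟩
      rw [Walk.support_cons]
      exact h2.trans (List.suffix_cons _ _).isInfix

lemma dist_split {V : Type*} {G : SimpleGraph V} (hc : G.Connected) {u v x y : V}
    (h : ¬ (G.deleteEdges {s(u, v)}).Reachable x y) :
    G.dist x y = G.dist x u + G.dist u y ∧ G.dist x y = G.dist x v + G.dist v y := by
  classical
  obtain ⟨p, hp⟩ := hc.exists_walk_length_eq_dist x y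
  have he := p.mem_edges_of_not_reachable_deleteEdges h
  have key : ∀ w ∈ p.support, G.dist x y = G.dist x w + G.dist w y := by
    intro w hw
    have h1 := dist_le (p.takeUntil w hw)
    have h2 := dist_le (p.dropUntil w hw)
    have h3 := congrArg Walk.length (p.take_spec hw)
    rw [Walk.length_append] at h3
    have h4 := hc.dist_triangle (u := x) (v := w) (w := y)
    omega
  exact ⟨key u (p.fst_mem_support_of_mem_edges he), key v (p.snd_mem_support_of_mem_edges he)⟩

lemma side {V : Type*} {G : SimpleGraph V} (hc : G.Connected) (u v x : V) :
    (G.deleteEdges {s(u, v)}).Reachable u x ∨ (G.deleteEdges {s(u, v)}).Reachable v x := by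
  obtain ⟨p⟩ := hc.preconnected u x
  have : ∀ y z, G.Walk y z →
      ((G.deleteEdges {s(u, v)}).Reachable u y ∨ (G.deleteEdges {s(u, v)}).Reachable v y) →
      ((G.deleteEdges {s(u, v)}).Reachable u z ∨ (G.deleteEdges {s(u, v)}).Reachable v z) := by
    intro y z q
    induction q with
    | nil => exact id
    | @cons a b c h q ih =>
      intro hy
      apply ih
      by_cases he : s(a, b) = s(u, v)
      · rcases Sym2.eq_iff.1 he with ⟨-, rfl⟩ | ⟨-, rfl⟩
        · exact Or.inr (Reachable.refl _)
        · exact Or.inl (Reachable.refl _)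
      · have hab : (G.deleteEdges {s(u, v)}).Adj a b := by
          rw [deleteEdges_adj]; exact ⟨h, he⟩
        exact hy.imp (fun h => h.trans hab.reachable) (fun h => h.trans hab.reachable)
  exact this _ _ p (Or.inl (Reachable.refl _))

lemma exists_leaf {V : Type*} [Fintype V] [DecidableEq V] {G : SimpleGraph V}
    [DecidableRel G.Adj] (hc : G.Connected) (ha : G.IsAcyclic) (hcard : 2 ≤ Fintype.card V)
    {u v : V} (hb : ¬ (G.deleteEdges {s(u, v)}).Reachable u v) :
    ∃ x, (G.deleteEdges {s(u, v)}).Reachable u x ∧ G.degree x = 1 := by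
  classical
  obtain ⟨x, hx, hmax⟩ := Finset.exists_max_image
    (Finset.univ.filter fun x => (G.deleteEdges {s(u, v)}).Reachable u x)
    (fun x => G.dist x v) ⟨u, by simp⟩
  simp only [Finset.mem_filter, Finset.mem_univ, true_and] at hx hmax
  refine ⟨x, hx, ?_⟩
  by_contra hdeg
  haveI : Nontrivial V := Fintype.one_lt_card_iff_nontrivial.1 hcard
  have hpos : 0 < G.degree x := hc.preconnected.degree_pos_of_nontrivial x
  obtain ⟨p, hp, hpl⟩ := hc.exists_path_of_dist x v
  have h2 : 1 < (G.neighborFinset x).card := by rw [card_neighborFinset_eq_degree]; omega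
  obtain ⟨y, hy, hne⟩ := Finset.exists_mem_ne h2 p.snd
  rw [mem_neighborFinset] at hy
  have hys : y ∉ p.support := fun h => hne (ha.eq_snd_of_adj_start hp hy h)
  have hq : (Walk.cons hy.symm p).IsPath := hp.cons hys
  obtain ⟨q, hq', hql⟩ := hc.exists_path_of_dist y v
  have heq : q = Walk.cons hy.symm p :=
    congrArg Subtype.val ((ha.subsingleton_path y v).elim ⟨q, hq'⟩ ⟨_, hq⟩)
  have hlen : q.length = p.length + 1 := by rw [heq, Walk.length_cons]
  have hxy : (G.deleteEdges {s(u, v)}).Adj x y := by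
    rw [deleteEdges_adj]
    refine ⟨hy, fun he => ?_⟩
    rcases Sym2.eq_iff.1 he with ⟨-, rfl⟩ | ⟨rfl, -⟩
    · exact hys p.end_mem_support
    · exact hb hx
  have := hmax y (hx.trans hxy.reachable)
  omega

lemma swap_lt {V : Type*} {G : SimpleGraph V} (hc : G.Connected) {u v a b c d : V}
    (huv : u ≠ v) (hb : ¬ (G.deleteEdges {s(u, v)}).Reachable u v)
    (h1 : (G.deleteEdges {s(u, v)}).Reachable u a) (h2 : (G.deleteEdges {s(u, v)}).Reachable u b)
    (h3 : (G.deleteEdges {s(u, v)}).Reachable v c) (h4 : (G.deleteEdges {s(u, v)}).Reachable v d) :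
    G.dist a b + G.dist c d < G.dist a d + G.dist c b := by
  have e1 := (dist_split hc (fun h => hb ((h1.trans h).trans h4.symm) :
    ¬ (G.deleteEdges {s(u, v)}).Reachable a d)).1
  have e2 := (dist_split hc (fun h => hb ((h2.trans h.symm).trans h3.symm) :
    ¬ (G.deleteEdges {s(u, v)}).Reachable c b)).1
  have e3 := (dist_split hc (fun h => hb (h.symm.trans h3.symm) :
    ¬ (G.deleteEdges {s(u, v)}).Reachable c u)).2
  have e4 := (dist_split hc (fun h => hb (h.trans h4.symm) :
    ¬ (G.deleteEdges {s(u, v)}).Reachable u d)).2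
  have t1 := hc.dist_triangle (u := a) (v := u) (w := b)
  have t2 := hc.dist_triangle (u := c) (v := v) (w := d)
  have := hc.pos_dist_of_ne huv
  omega

lemma sum_swap {k : ℕ} {V : Type*} (D : V → V → ℕ) (g h : Fin k → V) {i j : Fin k} (hij : i ≠ j)
    (hlt : D (g i) (h i) + D (g j) (h j) < D (g i) (h j) + D (g j) (h i)) :
    ∑ t, D (g t) (h t) < ∑ t, D (g t) (h (Equiv.swap i j t)) := by
  classical
  rw [← Finset.sum_sdiff (Finset.subset_univ {i, j}),
    ← Finset.sum_sdiff (f := fun t => D (g t) (h (Equiv.swap i j t))) (Finset.subset_univ {i, j}),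
    Finset.sum_pair hij, Finset.sum_pair hij]
  rw [Equiv.swap_apply_left, Equiv.swap_apply_right]
  have : ∑ t ∈ Finset.univ \ {i, j}, D (g t) (h t) =
      ∑ t ∈ Finset.univ \ {i, j}, D (g t) (h (Equiv.swap i j t)) := by
    refine Finset.sum_congr rfl fun t ht => ?_
    simp only [Finset.mem_sdiff, Finset.mem_insert, Finset.mem_singleton, not_or] at ht
    rw [Equiv.swap_apply_of_ne_of_ne ht.2.1 ht.2.2]
  omega

lemma leaf_end {V : Type*} [Fintype V] [DecidableEq V] {G : SimpleGraph V}
    [DecidableRel G.Adj] {x a b : V} (hx : G.degree x = 1) {l : List V} (hl : IsPathList G l)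
    (hab : [a, b] <:+: l) (hxab : x = a ∨ x = b) : l.head? = some x ∨ l.getLast? = some x := by
  obtain ⟨s, t, rfl⟩ := hab
  obtain ⟨-, hn, hch⟩ := hl
  have huniq : ∀ y z, G.Adj x y → G.Adj x z → y = z := by
    intro y z hy hz
    rw [← card_neighborFinset_eq_degree, Finset.card_eq_one] at hx
    obtain ⟨w, hw⟩ := hx
    rw [← mem_neighborFinset, hw, Finset.mem_singleton] at hy hz
    rw [hy, hz]
  replace hch : (s ++ [a, b] ++ t).IsChain G.Adj := hch
  rcases hxab with rfl | rfl
  · left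
    rcases List.eq_nil_or_concat s with rfl | ⟨s', c, rfl⟩
    · simp
    · exfalso
      have h1 : [c, x, b].IsChain G.Adj := hch.infix ⟨s', t, by simp⟩
      have h2 : [c, x, b].Nodup := hn.sublist (List.IsInfix.sublist ⟨s', t, by simp⟩)
      simp at h1 h2
      exact h2.1.2 (huniq _ _ h1.1.symm h1.2)
  · right
    cases t with
    | nil => simp
    | cons c t' =>
      exfalso
      have h1 : [a, x, c].IsChain G.Adj := hch.infix ⟨s, t', by simp⟩
      have h2 : [a, x, c].Nodup := hn.sublist (List.IsInfix.sublist ⟨s, t', by simp⟩)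
      simp at h1 h2
      exact h2.1.2 (huniq _ _ h1.1.symm h1.2)

lemma lower {V : Type*} [Fintype V] [DecidableEq V] {G : SimpleGraph V}
    [DecidableRel G.Adj] (C : Finset (List V)) (hC : ∀ l ∈ C, IsPathList G l)
    (hcov : CoversEdges G C) : Nat.card {v : V // G.degree v = 1} ≤ 2 * C.card := by
  classical
  rw [Nat.card_eq_fintype_card, Fintype.card_subtype,
    ← Finset.card_image_of_injective _ (Option.some_injective V)]
  have hsub : (Finset.univ.filter fun v => G.degree v = 1).image some ⊆
      C.image List.head? ∪ C.image List.getLast? := by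
    intro o ho
    simp only [Finset.mem_image, Finset.mem_filter, Finset.mem_univ, true_and] at ho
    obtain ⟨x, hx, rfl⟩ := ho
    obtain ⟨w, hw⟩ := (G.degree_pos_iff_exists_adj x).1 (by omega)
    obtain ⟨l, hl, a, b, he, hin⟩ := hcov s(x, w) hw
    have hxab : x = a ∨ x = b := by
      rcases Sym2.eq_iff.1 he with ⟨h, -⟩ | ⟨h, -⟩
      · exact Or.inl h
      · exact Or.inr h
    rw [Finset.mem_union, Finset.mem_image, Finset.mem_image]
    exact (leaf_end hx (hC l hl) hin hxab).imp (fun h => ⟨l, hl, h⟩) (fun h => ⟨l, hl, h⟩)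
  have h1 := Finset.card_le_card hsub
  have h2 := Finset.card_union_le (C.image List.head?) (C.image List.getLast?)
  have h3 : (C.image List.head?).card ≤ C.card := Finset.card_image_le
  have h4 : (C.image List.getLast?).card ≤ C.card := Finset.card_image_le
  omega

lemma exists_fun {V : Type*} [Fintype V] [Nonempty V] (P : V → Prop) (k : ℕ)
    (hk : Nat.card {v : V // P v} ≤ 2 * k) :
    ∃ g h : Fin k → V, ∀ x, P x → ∃ i, g i = x ∨ h i = x := by
  classical
  have hcard : Fintype.card {v : V // P v} ≤ Fintype.card (Fin k × Bool) := by
    rw [Fintype.card_prod, Fintype.card_fin, Fintype.card_bool, ← Nat.card_eq_fintype_card]; omega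
  obtain ⟨e⟩ := Function.Embedding.nonempty_of_card_le hcard
  let f : Fin k × Bool → V := Function.extend e Subtype.val fun _ => Classical.arbitrary V
  refine ⟨fun i => f (i, false), fun i => f (i, true), fun x hx => ⟨(e ⟨x, hx⟩).1, ?_⟩⟩
  have hf : f (e ⟨x, hx⟩) = x := e.injective.extend_apply _ _ _
  rcases h : e ⟨x, hx⟩ with ⟨i, b⟩
  rw [h] at hf
  cases b
  · exact Or.inl hf
  · exact Or.inr hf

lemma upper {V : Type*} [Fintype V] [DecidableEq V] {G : SimpleGraph V}
    [DecidableRel G.Adj] (hc : G.Connected) (ha : G.IsAcyclic) (hcard : 2 ≤ Fintype.card V)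
    (k : ℕ) (hk : Nat.card {v : V // G.degree v = 1} ≤ 2 * k) :
    ∃ C : Finset (List V), (∀ l ∈ C, IsPathList G l) ∧ CoversEdges G C ∧ C.card ≤ k := by
  classical
  haveI := hc.nonempty
  obtain ⟨g, h0, hgh0⟩ := exists_fun (fun v => G.degree v = 1) k hk
  obtain ⟨σ, hσ⟩ := Finite.exists_max fun σ : Equiv.Perm (Fin k) => ∑ t, G.dist (g t) (h0 (σ t))
  obtain ⟨h, hh⟩ : ∃ h : Fin k → V, h = fun t => h0 (σ t) := ⟨_, rfl⟩
  have hgh : ∀ x, G.degree x = 1 → ∃ i, g i = x ∨ h i = x := by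
    intro x hx
    obtain ⟨i, hi | hi⟩ := hgh0 x hx
    · exact ⟨i, Or.inl hi⟩
    · exact ⟨σ.symm i, Or.inr (by simp [hh, hi])⟩
  have hmax : ∀ i j : Fin k, ¬ ∑ t, G.dist (g t) (h t) <
      ∑ t, G.dist (g t) (h (Equiv.swap i j t)) := by
    intro i j hlt
    have := hσ ((Equiv.swap i j).trans σ)
    simp only [hh, Equiv.trans_apply] at hlt this
    omega
  choose p hp using fun t => hc.exists_isPath (g t) (h t)
  refine ⟨Finset.univ.image fun t => (p t).support, ?_, ?_, ?_⟩
  · intro l hl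
    simp only [Finset.mem_image, Finset.mem_univ, true_and] at hl
    obtain ⟨t, rfl⟩ := hl
    exact ⟨(p t).support_ne_nil, (hp t).support_nodup, (p t).isChain_adj_support⟩
  · intro e he
    by_contra hcon
    have hne : ∀ t, e ∉ (p t).edges := by
      intro t ht
      obtain ⟨a, b, h1, h2⟩ := infix_of_mem_edges _ _ ht
      exact hcon ⟨_, Finset.mem_image_of_mem _ (Finset.mem_univ t), a, b, h1, h2⟩
    clear hcon
    induction e with | _ u v
    have huv : G.Adj u v := he
    have hb : ¬ (G.deleteEdges {s(u, v)}).Reachable u v :=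
      isAcyclic_iff_forall_adj_isBridge.1 ha huv
    have hr : ∀ t, (G.deleteEdges {s(u, v)}).Reachable (g t) (h t) := fun t =>
      reachable_deleteEdges_iff_exists_walk.2 ⟨p t, hne t⟩
    obtain ⟨x, hx, hx1⟩ := exists_leaf hc ha hcard hb
    obtain ⟨y, hy, hy1⟩ := exists_leaf (u := v) (v := u) hc ha hcard
      (by rw [Sym2.eq_swap]; exact fun h => hb h.symm)
    rw [Sym2.eq_swap] at hy
    obtain ⟨i, hi⟩ := hgh x hx1
    obtain ⟨j, hj⟩ := hgh y hy1
    have hi1 : (G.deleteEdges {s(u, v)}).Reachable u (g i) := by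
      rcases hi with rfl | rfl
      · exact hx
      · exact hx.trans (hr i).symm
    have hj1 : (G.deleteEdges {s(u, v)}).Reachable v (g j) := by
      rcases hj with rfl | rfl
      · exact hy
      · exact hy.trans (hr j).symm
    have hij : i ≠ j := by
      rintro rfl
      exact hb (hi1.trans hj1.symm)
    exact hmax i j (sum_swap G.dist g h hij
      (swap_lt hc huv.ne hb hi1 (hi1.trans (hr i)) hj1 (hj1.trans (hr j))))
  · exact Finset.card_image_le.trans (by simp)

end PathCover

/-- For a finite tree `T` with at least two vertices and `ℓ` leaves, the minimum
number of paths of `T` needed to cover all edges of `T` equals `⌈ℓ/2⌉`. -/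
theorem edgeCover_by_paths_tree_min {V : Type*} [Fintype V] [DecidableEq V]
    (T : SimpleGraph V) [DecidableRel T.Adj]
    (hconn : T.Connected) (hacyclic : T.IsAcyclic)
    (hcard : 2 ≤ Fintype.card V)
    (ℓ : ℕ) (hℓ : ℓ = Nat.card {v : V // T.degree v = 1}) :
    IsLeast {n : ℕ | ∃ C : Finset (List V),
      (∀ l ∈ C, IsPathList T l) ∧ CoversEdges T C ∧ C.card = n}
      ((ℓ + 1) / 2) := by
  constructor
  · obtain ⟨C, h1, h2, h3⟩ := PathCover.upper hconn hacyclic hcard ((ℓ + 1) / 2) (by omega)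
    refine ⟨C, h1, h2, ?_⟩
    have := PathCover.lower C h1 h2
    omega
  · rintro n ⟨C, h1, h2, rfl⟩
    have := PathCover.lower C h1 h2
    omega
end

section
/- (Isolation Lemma) Let U be a finite set with n elements, let 𝒮 be a nonempty family of subsets of U, and let N be a positive integer. If a weight function w : U → {1, 2, …, N} is chosen uniformly at random (all N^n functions equally likely), then the probability that there is a unique set S ∈ 𝒮 minimizing Σ_{x ∈ S} w(x) over all members of 𝒮 is at least 1 − n/N. -/
/-- The weight function `w : U → {1,…,N}` (encoded as `w : U → Fin N`, with
`x` having weight `(w x : ℕ) + 1`) isolates the family `𝒮`: there is a unique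
member of `𝒮` of minimum weight. -/
def Isolates {U : Type*} {N : ℕ} (𝒮 : Finset (Finset U)) (w : U → Fin N) : Prop :=
  ∃! S, S ∈ 𝒮 ∧ ∀ S' ∈ 𝒮, ∑ x ∈ S, ((w x : ℕ) + 1) ≤ ∑ x ∈ S', ((w x : ℕ) + 1)

/-- `S` is a minimizer. -/
def IsolMin {U : Type*} {N : ℕ} (𝒮 : Finset (Finset U)) (w : U → Fin N) (S : Finset U) : Prop :=
  S ∈ 𝒮 ∧ ∀ S' ∈ 𝒮, ∑ x ∈ S, ((w x : ℕ) + 1) ≤ ∑ x ∈ S', ((w x : ℕ) + 1)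

/-- `x` is ambiguous for `w`. -/
def IsolBad {U : Type*} {N : ℕ} (𝒮 : Finset (Finset U)) (x : U) (w : U → Fin N) : Prop :=
  ∃ S T, IsolMin 𝒮 w S ∧ IsolMin 𝒮 w T ∧ x ∈ S ∧ x ∉ T

theorem isol_le {U : Type*} [DecidableEq U] {N : ℕ} (𝒮 : Finset (Finset U)) (x : U)
    (w w' : U → Fin N) (hw : IsolBad 𝒮 x w) (hw' : IsolBad 𝒮 x w')
    (h : ∀ y, y ≠ x → w y = w' y) : w' x ≤ w x := by
  obtain ⟨S, T, hS, hT, hxS, hxT⟩ := hw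
  obtain ⟨S', T', hS', hT', hxS', hxT'⟩ := hw'
  have h1 := hS'.2 T hT.1
  have h2 : ∑ y ∈ T, ((w' y : ℕ) + 1) = ∑ y ∈ T, ((w y : ℕ) + 1) := by
    refine Finset.sum_congr rfl fun y hy => ?_
    rw [h y (fun e => hxT (e ▸ hy))]
  have h3 := hT.2 S' hS'.1
  have h4 : ∑ y ∈ S'.erase x, ((w' y : ℕ) + 1) = ∑ y ∈ S'.erase x, ((w y : ℕ) + 1) := by
    refine Finset.sum_congr rfl fun y hy => ?_
    rw [h y (Finset.ne_of_mem_erase hy)]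
  have h5 := Finset.add_sum_erase S' (fun y => (w y : ℕ) + 1) hxS'
  have h6 := Finset.add_sum_erase S' (fun y => (w' y : ℕ) + 1) hxS'
  rw [Fin.le_def]
  omega

open Classical in
theorem isol_card {U : Type*} [Fintype U] {N : ℕ} (𝒮 : Finset (Finset U)) (x : U) :
    (Finset.univ.filter (fun w : U → Fin N => IsolBad 𝒮 x w)).card * N
      ≤ N ^ Fintype.card U := by
  have key : ((Finset.univ.filter (fun w : U → Fin N => IsolBad 𝒮 x w)) ×ˢ
      (Finset.univ : Finset (Fin N))).card ≤ (Finset.univ : Finset (U → Fin N)).card := by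
    refine Finset.card_le_card_of_injOn (fun p => Function.update p.1 x p.2)
      (fun _ _ => Finset.mem_coe.2 (Finset.mem_univ _)) ?_
    rintro ⟨w, c⟩ hw ⟨w', c'⟩ hw' he
    simp only [Finset.coe_product, Set.mem_prod, Finset.mem_coe, Finset.mem_filter,
      Finset.mem_univ, true_and, and_true] at hw hw'
    simp only at he
    have hc : c = c' := by simpa using congrFun he x
    have hoff : ∀ y, y ≠ x → w y = w' y := fun y hy => by
      simpa [Function.update_of_ne hy] using congrFun he y
    have hx : w x = w' x := le_antisymm
      (isol_le 𝒮 x w' w hw' hw fun y hy => (hoff y hy).symm) (isol_le 𝒮 x w w' hw hw' hoff)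
    have : w = w' := by
      funext y
      by_cases hy : y = x
      · rw [hy, hx]
      · exact hoff y hy
    rw [this, hc]
  simpa [Finset.card_product] using key

theorem isol_exists {U : Type*} {N : ℕ} (𝒮 : Finset (Finset U)) (h𝒮 : 𝒮.Nonempty)
    (w : U → Fin N) (h : ¬ Isolates 𝒮 w) : ∃ x, IsolBad 𝒮 x w := by
  by_contra! hx
  apply h
  obtain ⟨S, hS, hm⟩ := Finset.exists_min_image 𝒮 (fun S => ∑ x ∈ S, ((w x : ℕ) + 1)) h𝒮
  refine ⟨S, ⟨hS, hm⟩, fun T hT => ?_⟩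
  ext x
  constructor
  · intro h1
    by_contra h2
    exact hx x ⟨T, S, hT, ⟨hS, hm⟩, h1, h2⟩
  · intro h1
    by_contra h2
    exact hx x ⟨S, T, ⟨hS, hm⟩, hT, h1, h2⟩

/-- Isolation Lemma: if `𝒮` is a nonempty family of subsets of an `n`-element
set `U` and the weights `w : U → {1,…,N}` are chosen uniformly at random (all
`N^n` weight functions equally likely), then `w` isolates `𝒮` with probability
at least `1 - n/N`. -/
theorem isolation_lemma (U : Type*) [Fintype U] [DecidableEq U]
    (n : ℕ) (hn : n = Fintype.card U)
    (𝒮 : Finset (Finset U)) (h𝒮 : 𝒮.Nonempty)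
    (N : ℕ) (hN : 0 < N) :
    (1 : ℚ) - (n : ℚ) / (N : ℚ) ≤
      (Nat.card {w : U → Fin N // Isolates 𝒮 w} : ℚ) / ((N : ℚ) ^ n) := by
  classical
  subst hn
  have hcard : Nat.card {w : U → Fin N // Isolates 𝒮 w}
      = (Finset.univ.filter (fun w : U → Fin N => Isolates 𝒮 w)).card := by
    rw [Nat.card_eq_fintype_card, Fintype.card_subtype]
  have hsum := Finset.card_filter_add_card_filter_not (s := (Finset.univ : Finset (U → Fin N)))
    (fun w => Isolates 𝒮 w)
  have htot : (Finset.univ : Finset (U → Fin N)).card = N ^ Fintype.card U := by simp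
  have hbad : (Finset.univ.filter (fun w : U → Fin N => ¬ Isolates 𝒮 w)).card * N
      ≤ Fintype.card U * N ^ Fintype.card U := by
    calc _ ≤ (∑ x : U, (Finset.univ.filter (fun w : U → Fin N => IsolBad 𝒮 x w)).card) * N := by
          refine Nat.mul_le_mul_right _ (le_trans (Finset.card_le_card ?_) Finset.card_biUnion_le)
          intro w hw
          obtain ⟨x, hx⟩ := isol_exists 𝒮 h𝒮 w (Finset.mem_filter.1 hw).2
          exact Finset.mem_biUnion.2 ⟨x, Finset.mem_univ _, by simpa using hx⟩
      _ = ∑ x : U, (Finset.univ.filter (fun w : U → Fin N => IsolBad 𝒮 x w)).card * N :=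
          Finset.sum_mul _ _ _
      _ ≤ ∑ _x : U, N ^ Fintype.card U := Finset.sum_le_sum fun x _ => by
          refine le_trans (le_of_eq ?_) (isol_card (N := N) 𝒮 x)
          congr!
      _ = _ := by simp
  rw [hcard]
  rw [htot] at hsum
  generalize (Finset.univ.filter (fun w : U → Fin N => ¬ Isolates 𝒮 w)).card = b at *
  generalize (Finset.univ.filter (fun w : U → Fin N => Isolates 𝒮 w)).card = g at *
  have hN' : (0 : ℚ) < N := by exact_mod_cast hN
  have hP : (0 : ℚ) < (N : ℚ) ^ Fintype.card U := by positivity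
  have hs : (g : ℚ) + b = (N : ℚ) ^ Fintype.card U := by exact_mod_cast hsum
  have hb : (b : ℚ) * N ≤ Fintype.card U * (N : ℚ) ^ Fintype.card U := by exact_mod_cast hbad
  have h1 : (b : ℚ) / (N : ℚ) ^ Fintype.card U ≤ Fintype.card U / N := by
    rw [div_le_div_iff₀ hP hN']
    exact hb
  have h2 : (g : ℚ) / (N : ℚ) ^ Fintype.card U + b / (N : ℚ) ^ Fintype.card U = 1 := by
    rw [← add_div, hs, div_self hP.ne']
  linarith
end

section
/- Let H be a finite simple graph on vertex set V and let M ⊆ V. Let c be the number of connected components of H that contain no vertex of M. Then the number of subsets V₁ ⊆ V such that M ⊆ V₁ and no edge of H joins a vertex of V₁ to a vertex of V \ V₁ equals 2^c. -/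
/-- Let `H` be a finite simple graph and `M` a set of its vertices, and let `c`
be the number of connected components of `H` containing no vertex of `M`. Then
the number of vertex subsets `V₁` with `M ⊆ V₁` such that no edge of `H` joins
a vertex of `V₁` to a vertex outside `V₁` equals `2 ^ c`. -/
theorem consistent_cuts_count {V : Type*} [Fintype V]
    (H : SimpleGraph V) (M : Set V)
    (c : ℕ) (hc : c = Nat.card {C : H.ConnectedComponent // ∀ v ∈ M, v ∉ C.supp}) :
    Nat.card {V₁ : Set V // M ⊆ V₁ ∧ ∀ u v : V, H.Adj u v → ¬(u ∈ V₁ ∧ v ∉ V₁)}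
      = 2 ^ c := by
  classical
  have : Finite H.ConnectedComponent := Quot.finite _
  have := Fintype.ofFinite {C : H.ConnectedComponent // ∀ v ∈ M, v ∉ C.supp}
  have hcard : Nat.card (Set {C : H.ConnectedComponent // ∀ v ∈ M, v ∉ C.supp}) = 2 ^ c := by
    rw [hc, Nat.card_eq_fintype_card, Nat.card_eq_fintype_card, Fintype.card_set]
  rw [← hcard]
  symm
  refine Nat.card_eq_of_bijective
    (fun S => ⟨{v | ∀ h : (∀ w ∈ M, w ∉ (H.connectedComponentMk v).supp),
        (⟨H.connectedComponentMk v, h⟩ :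
          {C : H.ConnectedComponent // ∀ v ∈ M, v ∉ C.supp}) ∈ S}, ?_, ?_⟩) ⟨?_, ?_⟩
  · intro v hv h
    exact absurd rfl (h v hv)
  · rintro u v huv ⟨hu, hv⟩
    apply hv
    have e : H.connectedComponentMk u = H.connectedComponentMk v :=
      SimpleGraph.ConnectedComponent.sound huv.reachable
    simp only [Set.mem_setOf_eq] at hu ⊢
    rw [← e]
    exact hu
  · intro S T hST
    have h1 := congrArg Subtype.val hST
    ext ⟨C, hC⟩
    induction C using SimpleGraph.ConnectedComponent.ind with
    | h v =>
      have h2 := Set.ext_iff.mp h1 v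
      simp only [Set.mem_setOf_eq] at h2
      exact ⟨fun h => h2.mp (fun _ => h) hC, fun h => h2.mpr (fun _ => h) hC⟩
  · rintro ⟨W, hM, hW⟩
    have key : ∀ u v, H.Reachable u v → u ∈ W → v ∈ W := by
      rintro u v ⟨p⟩
      induction p with
      | nil => exact id
      | cons hadj _ ih =>
        intro hu
        exact ih (by by_contra hn; exact hW _ _ hadj ⟨hu, hn⟩)
    refine ⟨{C | ∃ v ∈ W, H.connectedComponentMk v = C.1}, ?_⟩
    apply Subtype.ext
    ext v
    simp only [Set.mem_setOf_eq]
    constructor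
    · intro h
      by_cases hg : ∀ w ∈ M, w ∉ (H.connectedComponentMk v).supp
      · obtain ⟨u, hu, e⟩ := h hg
        exact key u v (SimpleGraph.ConnectedComponent.exact e) hu
      · push Not at hg
        obtain ⟨w, hw, e⟩ := hg
        exact key w v (SimpleGraph.ConnectedComponent.exact e) (hM hw)
    · intro hv _
      exact ⟨v, hv, rfl⟩
end

section
/- Let G = (V, E) be a finite simple graph, let k be a nonnegative integer, let w : V ∪ E → ℕ be a weight function, and let ω be a nonnegative integer. Define R_ω as the set of pairs (P, M) where P ⊆ E is such that the spanning subgraph (V, P) is a linear forest, M ⊆ V with |M| = k, and Σ_{e ∈ P} w(e) + Σ_{v ∈ M} w(v) = ω. Define S_ω as the set of pairs (P, M) ∈ R_ω such that every connected component of (V, P) contains a vertex of M. Define C_ω as the set of triples (P, M, V₁) where (P, M) ∈ R_ω, M ⊆ V₁ ⊆ V, and no edge of P joins a vertex of V₁ to a vertex of V \ V₁. Then |S_ω| ≡ |C_ω| (mod 2). -/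
/-- The spanning subgraph `(V, P)` with edge set `P` is a linear forest: it is
acyclic and every vertex has degree at most 2. -/
def IsLinearForestEdgeSet {V : Type*} (P : Set (Sym2 V)) : Prop :=
  (SimpleGraph.fromEdgeSet P).IsAcyclic ∧
    ∀ v : V, ((SimpleGraph.fromEdgeSet P).neighborSet v).ncard ≤ 2

/-- `(P, M)` is a member of `R_ω`: `P ⊆ E(G)`, the spanning subgraph `(V, P)`
is a linear forest, `|M| = k`, and the total weight of `P ∪ M` is `ω`. -/
def MemR {V : Type*} [DecidableEq V] (G : SimpleGraph V) (k : ℕ)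
    (wV : V → ℕ) (wE : Sym2 V → ℕ) (ω : ℕ)
    (PM : Finset (Sym2 V) × Finset V) : Prop :=
  ↑PM.1 ⊆ G.edgeSet ∧ IsLinearForestEdgeSet (↑PM.1 : Set (Sym2 V)) ∧
    PM.2.card = k ∧ (∑ e ∈ PM.1, wE e) + (∑ v ∈ PM.2, wV v) = ω

theorem card_invol {T : Type*} [Finite T] (f : T → T) (hf : Function.Involutive f) :
    Nat.card T ≡ Nat.card (Function.fixedPoints f) [MOD 2] := by
  classical
  haveI := Fintype.ofFinite T
  let g : Function.End T := f
  have hg : g ^ 2 ^ 1 = 1 := by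
    rw [pow_one, pow_two]
    exact funext hf
  have := Equiv.Perm.card_fixedPoints_modEq hg
  rw [← Nat.card_eq_fintype_card, ← Nat.card_eq_fintype_card] at this
  exact this

open Classical in
theorem exists_D {V : Type*} [DecidableEq V] (PM : Finset (Sym2 V) × Finset V) :
    ∃ D : Set V, (∀ u v : V, s(u, v) ∈ PM.1 → (u ∈ D ↔ v ∈ D)) ∧ (∀ v ∈ PM.2, v ∉ D) ∧
      (D = ∅ ↔ ∀ C : (SimpleGraph.fromEdgeSet (↑PM.1 : Set (Sym2 V))).ConnectedComponent,
          ∃ v ∈ PM.2, v ∈ C.supp) := by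
  by_cases h : ∀ C : (SimpleGraph.fromEdgeSet (↑PM.1 : Set (Sym2 V))).ConnectedComponent,
          ∃ v ∈ PM.2, v ∈ C.supp
  · exact ⟨∅, by simp, by simp, by simpa using h⟩
  · have h0 := h
    push Not at h
    obtain ⟨C, hC⟩ := h
    refine ⟨C.supp, ?_, hC, ?_⟩
    · intro u v huv
      by_cases e : u = v
      · rw [e]
      · have : (SimpleGraph.fromEdgeSet (↑PM.1 : Set (Sym2 V))).Adj u v := by
          rw [SimpleGraph.fromEdgeSet_adj]; exact ⟨huv, e⟩
        exact C.mem_supp_congr_adj this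
    · exact iff_of_false C.nonempty_supp.ne_empty h0

theorem reach_mem {V : Type*} (P : Finset (Sym2 V)) (A : Set V)
    (hA : ∀ u v : V, s(u, v) ∈ P → ¬(u ∈ A ∧ v ∉ A)) {u v : V}
    (h : (SimpleGraph.fromEdgeSet (↑P : Set (Sym2 V))).Reachable u v) (hu : u ∈ A) : v ∈ A := by
  obtain ⟨p⟩ := h
  induction p with
  | nil => exact hu
  | cons hadj p ih =>
    rw [SimpleGraph.fromEdgeSet_adj] at hadj
    apply ih
    by_contra hv
    exact hA _ _ hadj.1 ⟨hu, hv⟩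

/-- `|S_ω| ≡ |C_ω| (mod 2)`: the number of pairs `(P, M) ∈ R_ω` in which every
connected component of `(V, P)` contains a marked vertex is congruent modulo 2
to the number of triples `(P, M, V₁)` with `(P, M) ∈ R_ω`, `M ⊆ V₁ ⊆ V`, and no
edge of `P` joining `V₁` to `V \ V₁` (a consistent cut with all markers on one
side). -/
theorem count_S_eq_count_C_mod_two {V : Type*} [Fintype V] [DecidableEq V]
    (G : SimpleGraph V) (k : ℕ) (wV : V → ℕ) (wE : Sym2 V → ℕ) (ω : ℕ) :
    Nat.card {PM : Finset (Sym2 V) × Finset V //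
        MemR G k wV wE ω PM ∧
        ∀ C : (SimpleGraph.fromEdgeSet (↑PM.1 : Set (Sym2 V))).ConnectedComponent,
          ∃ v ∈ PM.2, v ∈ C.supp}
      ≡ Nat.card {PMV : (Finset (Sym2 V) × Finset V) × Set V //
        MemR G k wV wE ω PMV.1 ∧ ↑PMV.1.2 ⊆ PMV.2 ∧
        ∀ u v : V, s(u, v) ∈ PMV.1.1 → ¬(u ∈ PMV.2 ∧ v ∉ PMV.2)} [MOD 2] := by
  classical
  choose D hD1 hD2 hD3 using @exists_D V _
  let T := {PMV : (Finset (Sym2 V) × Finset V) × Set V //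
        MemR G k wV wE ω PMV.1 ∧ ↑PMV.1.2 ⊆ PMV.2 ∧
        ∀ u v : V, s(u, v) ∈ PMV.1.1 → ¬(u ∈ PMV.2 ∧ v ∉ PMV.2)}
  let f : T → T := fun x => ⟨(x.1.1, symmDiff x.1.2 (D x.1.1)), x.2.1, by
      intro v hv
      exact Or.inl ⟨x.2.2.1 hv, hD2 _ v hv⟩, by
      intro u v huv
      have h1 := x.2.2.2 u v huv
      have h2 := x.2.2.2 v u (by rw [Sym2.eq_swap]; exact huv)
      have h3 := hD1 _ u v huv
      simp only [Set.mem_symmDiff]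
      tauto⟩
  have hf : Function.Involutive f := by
    intro x
    apply Subtype.ext
    apply Prod.ext
    · rfl
    · exact symmDiff_symmDiff_cancel_right _ _
  have key : Nat.card T ≡ Nat.card (Function.fixedPoints f) [MOD 2] := card_invol f hf
  refine Nat.ModEq.trans ?_ key.symm
  have hfix : ∀ x : T, f x = x ↔ D x.1.1 = ∅ := by
    intro x
    constructor
    · intro h
      have h1 : symmDiff x.1.2 (D x.1.1) = x.1.2 := congrArg (fun y : T => y.1.2) h
      exact symmDiff_eq_left.mp h1
    · intro h
      apply Subtype.ext
      apply Prod.ext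
      · rfl
      · exact symmDiff_eq_left.mpr h
  refine congrArg (· % 2) (Nat.card_congr (Equiv.ofBijective (fun a => ⟨⟨(a.1, Set.univ), a.2.1,
    Set.subset_univ _, fun u v _ h => h.2 trivial⟩, (hfix _).2 ((hD3 _).2 a.2.2)⟩) ⟨?_, ?_⟩))
  · intro a b h
    apply Subtype.ext
    exact congrArg (fun y => y.1.1.1) h
  · rintro ⟨x, hx⟩
    have hall := (hD3 _).1 ((hfix x).1 hx)
    refine ⟨⟨x.1.1, x.2.1, hall⟩, ?_⟩
    apply Subtype.ext
    apply Subtype.ext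
    apply Prod.ext
    · rfl
    · symm
      apply Set.eq_univ_of_forall
      intro v
      obtain ⟨m, hm, hmC⟩ := hall (SimpleGraph.connectedComponentMk _ v)
      exact reach_mem _ _ x.2.2.2 (SimpleGraph.ConnectedComponent.exact hmC) (x.2.2.1 hm)
end
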